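/- arXiv:1107.3870 — 2 statements merged into one kernel-verified Lean document; each statement's English description precedes it below -/
import Mathlib

section
/- Let p ≥ 1 be an integer and let m, n be natural numbers with m > pn. Then the number of lattice paths from (1,0) to (m,n) with unit up steps (0,1) and unit right steps (1,0) in which every point (a,b) on the path satisfies a > pb equals C(m+n−1, m−1) − p·C(m+n−1, m) (as an integer); equivalently, (m+n) times this number equals (m − pn)·C(m+n, m). -/
/-- The number of entries of value `b` among the first `k` entries of `s`. -/
def countUpto {L : ℕ} (s : Fin L → Bool) (k : ℕ) (b : Bool) : ℕ :=
  (Finset.univ.filter fun i : Fin L => i.val < k ∧ s i = b).card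

/-- The number of monotone lattice paths starting at `(a, b)`, consisting of `r` unit right
steps `(1,0)` and `u` unit up steps `(0,1)` in some order (hence ending at `(a + r, b + u)`),
such that every point `(x, y)` visited by the path satisfies `ok x y`.  A path is encoded by
the sequence of its steps: `s i = true` means the `i`-th step is a right step and
`s i = false` means it is an up step. -/
def monoPathCount (a b : ℤ) (r u : ℕ) (ok : ℤ → ℤ → Prop)
    [∀ x y, Decidable (ok x y)] : ℕ :=
  (Finset.univ.filter fun s : Fin (r + u) → Bool =>
    countUpto s (r + u) true = r ∧
    ∀ k, k ≤ r + u →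
      ok (a + (countUpto s k true : ℤ)) (b + (countUpto s k false : ℤ))).card

theorem countUpto_snoc_of_le {L : ℕ} (s : Fin L → Bool) (b c : Bool) {k : ℕ} (hk : k ≤ L) :
    countUpto (Fin.snoc s b : Fin (L + 1) → Bool) k c = countUpto s k c := by
  simp [countUpto, Finset.card_filter, Fin.sum_univ_castSucc, -Finset.sum_boole, hk]

theorem countUpto_snoc_last {L : ℕ} (s : Fin L → Bool) (b c : Bool) :
    countUpto (Fin.snoc s b : Fin (L + 1) → Bool) (L + 1) c =
      countUpto s L c + if b = c then 1 else 0 := by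
  simp [countUpto, Finset.card_filter, Fin.sum_univ_castSucc, -Finset.sum_boole]

theorem countUpto_true_add_false {L : ℕ} (s : Fin L → Bool) :
    countUpto s L true + countUpto s L false = L := by
  simp only [countUpto, Fin.is_lt, true_and]
  simpa using Finset.card_filter_add_card_filter_not
    (s := (Finset.univ : Finset (Fin L))) (fun i => s i = true)

/-- The step sequences of length `L` with `r` right steps whose path from `(1, 0)` stays
strictly below the line `x = p * y`. -/
def ballotPaths (p L r : ℕ) : Finset (Fin L → Bool) :=
  Finset.univ.filter fun s =>
    countUpto s L true = r ∧ ∀ k ≤ L, p * countUpto s k false ≤ countUpto s k true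

theorem mem_ballotPaths {p L r : ℕ} {s : Fin L → Bool} :
    s ∈ ballotPaths p L r ↔
      countUpto s L true = r ∧ ∀ k ≤ L, p * countUpto s k false ≤ countUpto s k true := by
  simp [ballotPaths]

/-- Extending a path by one step, when the endpoint of the extension is admissible. -/
theorem snoc_mem_ballotPaths {p L r : ℕ} (h : p * (L + 1) ≤ p * r + r) (s : Fin L → Bool)
    (b : Bool) :
    (Fin.snoc s b : Fin (L + 1) → Bool) ∈ ballotPaths p (L + 1) r ↔
      countUpto s L true + (if b = true then 1 else 0) = r ∧
        ∀ k ≤ L, p * countUpto s k false ≤ countUpto s k true := by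
  rw [mem_ballotPaths, countUpto_snoc_last]
  refine and_congr_right fun hr => ⟨fun H k hk => ?_, fun H k hk => ?_⟩
  · simpa only [countUpto_snoc_of_le _ _ _ hk] using H k (by omega)
  · obtain hk | rfl := Nat.le_succ_iff.mp hk
    · simpa only [countUpto_snoc_of_le _ _ _ hk] using H k hk
    · have hsum := countUpto_true_add_false (Fin.snoc s b : Fin (L + 1) → Bool)
      rw [countUpto_snoc_last s b true, hr] at hsum
      rw [Nat.succ_eq_add_one, countUpto_snoc_last s b true, hr]
      rw [← hsum, mul_add] at h
      omega

theorem card_ballotPaths_succ {p L r : ℕ} (h : p * (L + 1) ≤ p * (r + 1) + (r + 1)) :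
    (ballotPaths p (L + 1) (r + 1)).card =
      (ballotPaths p L r).card + (ballotPaths p L (r + 1)).card := by
  have key : (ballotPaths p (L + 1) (r + 1)).card =
      ∑ s : Fin (L + 1) → Bool, if s ∈ ballotPaths p (L + 1) (r + 1) then 1 else 0 := by
    simp
  rw [key, ← (Fin.snocEquiv fun _ : Fin (L + 1) => Bool).sum_comp, Fintype.sum_prod_type,
    Fintype.sum_bool]
  simp only [Fin.snocEquiv, Equiv.coe_fn_mk, snoc_mem_ballotPaths h]
  simp [ballotPaths, Finset.card_filter, -Finset.sum_boole]

theorem card_ballotPaths_eq_zero {p L r : ℕ} (h : p * r + r < p * L) :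
    (ballotPaths p L r).card = 0 := by
  rw [Finset.card_eq_zero, Finset.eq_empty_iff_forall_notMem]
  intro s hs
  obtain ⟨hr, H⟩ := mem_ballotPaths.mp hs
  have hsum := countUpto_true_add_false s
  have hL := H L le_rfl
  rw [hr] at hsum hL
  rw [← hsum, mul_add] at h
  omega

theorem choose_eq_mul_choose_succ {p L r : ℕ} (h : p * L = p * r + r + 1) :
    L.choose r = p * L.choose (r + 1) := by
  have hrL : r ≤ L := by
    by_contra! hlt
    have := Nat.mul_le_mul_left p hlt.le
    omega
  obtain ⟨u, rfl⟩ := Nat.exists_eq_add_of_le hrL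
  have hu : p * u = r + 1 := by rw [mul_add] at h; omega
  have hc := Nat.choose_succ_right_eq (r + u) r
  rw [Nat.add_sub_cancel_left] at hc
  refine Nat.eq_of_mul_eq_mul_right (Nat.succ_pos r) ?_
  calc (r + u).choose r * (r + 1) = p * ((r + u).choose r * u) := by rw [← hu]; ring
    _ = p * (r + u).choose (r + 1) * (r + 1) := by rw [← hc]; ring

theorem card_ballotPaths {p : ℕ} (hp : 1 ≤ p) (L r : ℕ) (h : p * L ≤ p * r + r + 1) :
    ((ballotPaths p L r).card : ℤ) = (L.choose r : ℤ) - p * (L.choose (r + 1) : ℤ) := by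
  induction L generalizing r with
  | zero => cases r <;> simp [ballotPaths, countUpto]
  | succ L ih =>
    obtain h | h := h.eq_or_lt
    · rw [card_ballotPaths_eq_zero (by omega), choose_eq_mul_choose_succ h]
      simp
    · cases r with
      | zero =>
        have := Nat.mul_le_mul hp (Nat.le_add_left 1 L)
        omega
      | succ r =>
        rw [card_ballotPaths_succ (by omega), Nat.cast_add, ih r (by linarith),
          ih (r + 1) (by linarith), Nat.choose_succ_succ L r, Nat.choose_succ_succ L (r + 1)]
        push_cast
        ring

theorem monoPathCount_eq_card_ballotPaths (p r u : ℕ) :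
    monoPathCount 1 0 r u (fun x y => (p : ℤ) * y < x) = (ballotPaths p (r + u) r).card := by
  unfold monoPathCount ballotPaths
  congr 1
  ext s
  simp only [Finset.mem_filter, Finset.mem_univ, true_and]
  refine and_congr_right fun _ => forall₂_congr fun k _ => ?_
  rw [zero_add, add_comm (1 : ℤ), Int.lt_add_one_iff]
  norm_cast

/-- For `p ≥ 1` and `m > pn`, the number of lattice paths from `(1,0)` to `(m,n)` all of
whose points `(a,b)` satisfy `a > pb` is `C(m+n-1, m-1) - p·C(m+n-1, m)`; equivalently,
`(m+n)` times this number is `(m - pn)·C(m+n, m)`. -/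
theorem stmt_10 (p : ℕ) (hp : 1 ≤ p) (m n : ℕ) (hmn : p * n < m) :
    (monoPathCount 1 0 (m - 1) n (fun x y => (p : ℤ) * y < x) : ℤ) =
        ((m + n - 1).choose (m - 1) : ℤ) - (p : ℤ) * ((m + n - 1).choose m : ℤ) ∧
      ((m : ℤ) + n) * (monoPathCount 1 0 (m - 1) n (fun x y => (p : ℤ) * y < x) : ℤ) =
        ((m : ℤ) - (p : ℤ) * n) * ((m + n).choose m : ℤ) := by
  obtain ⟨r, rfl⟩ : ∃ r, m = r + 1 := Nat.exists_eq_succ_of_ne_zero (by omega)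
  have hcount : (monoPathCount 1 0 (r + 1 - 1) n (fun x y => (p : ℤ) * y < x) : ℤ) =
      ((r + n).choose r : ℤ) - (p : ℤ) * ((r + n).choose (r + 1) : ℤ) := by
    rw [Nat.add_sub_cancel, monoPathCount_eq_card_ballotPaths]
    exact card_ballotPaths hp _ _ (by rw [mul_add]; omega)
  have hN : r + 1 + n = r + n + 1 := by omega
  rw [hcount, hN, Nat.add_sub_cancel, Nat.add_sub_cancel]
  refine ⟨rfl, ?_⟩
  have h₁ : ((r : ℤ) + n + 1) * (r + n).choose r = (r + n + 1).choose (r + 1) * (r + 1) := by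
    exact_mod_cast Nat.add_one_mul_choose_eq (r + n) r
  have h₂ : ((r + n + 1).choose (r + 1) : ℤ) = (r + n).choose r + (r + n).choose (r + 1) := by
    exact_mod_cast Nat.choose_succ_succ (r + n) r
  push_cast
  linear_combination (1 + p : ℤ) * h₁ + p * (r + n + 1) * h₂
end

section
/- Let p ≥ 1 be an integer and n a natural number. Then (pn+1) times the number of lattice paths from (0,0) to (n, pn) with unit up steps (0,1) and unit right steps (1,0) in which every point (a,b) on the path satisfies b ≤ pa equals the binomial coefficient C((p+1)n, n). -/
/-- A step sequence of any length `L`, started at `(a, b)`, has exactly `r` right steps and all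
the points it visits satisfy `ok`. -/
def IsValidPath {L : ℕ} (ok : ℤ → ℤ → Prop) (a b : ℤ) (r : ℕ) (s : Fin L → Bool) : Prop :=
  countUpto s L true = r ∧
    ∀ k, k ≤ L → ok (a + (countUpto s k true : ℤ)) (b + (countUpto s k false : ℤ))

open Classical in
/-- The number of valid step sequences of length `L` from `(a, b)` with `r` right steps. -/
noncomputable def validPathCount (ok : ℤ → ℤ → Prop) (L : ℕ) (a b : ℤ) (r : ℕ) : ℕ :=
  (Finset.univ.filter fun s : Fin L → Bool => IsValidPath ok a b r s).card

theorem countUpto_zero {L : ℕ} (s : Fin L → Bool) (b : Bool) : countUpto s 0 b = 0 := by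
  simp [countUpto]

theorem countUpto_cons_succ {L : ℕ} (c : Bool) (s : Fin L → Bool) (k : ℕ) (b : Bool) :
    countUpto (Fin.cons c s : Fin (L + 1) → Bool) (k + 1) b =
      (if c = b then 1 else 0) + countUpto s k b := by
  simp only [countUpto, Finset.card_filter, Fin.sum_univ_succ, Fin.cons_zero, Fin.cons_succ,
    Fin.val_zero, Fin.val_succ, Nat.succ_pos, true_and, Nat.add_lt_add_iff_right]

theorem forall_le_succ_iff (P : ℕ → Prop) (L : ℕ) :
    (∀ k, k ≤ L + 1 → P k) ↔ P 0 ∧ ∀ k, k ≤ L → P (k + 1) := by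
  refine ⟨fun h => ⟨h 0 (by omega), fun k hk => h _ (by omega)⟩, fun h k hk => ?_⟩
  cases k with
  | zero => exact h.1
  | succ k => exact h.2 k (by omega)

theorem isValidPath_cons_false {L : ℕ} (ok : ℤ → ℤ → Prop) (a b : ℤ) (r : ℕ)
    (s : Fin L → Bool) :
    IsValidPath ok a b r (Fin.cons false s : Fin (L + 1) → Bool) ↔
      ok a b ∧ IsValidPath ok a (b + 1) r s := by
  simp only [IsValidPath, forall_le_succ_iff, countUpto_cons_succ, countUpto_zero]
  simp only [Bool.false_eq_true, if_false, if_true, zero_add, Nat.cast_zero, add_zero,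
    Nat.cast_add, Nat.cast_one, ← add_assoc]
  tauto

theorem isValidPath_cons_true_succ {L : ℕ} (ok : ℤ → ℤ → Prop) (a b : ℤ) (r : ℕ)
    (s : Fin L → Bool) :
    IsValidPath ok a b (r + 1) (Fin.cons true s : Fin (L + 1) → Bool) ↔
      ok a b ∧ IsValidPath ok (a + 1) b r s := by
  simp only [IsValidPath, forall_le_succ_iff, countUpto_cons_succ, countUpto_zero]
  simp only [Bool.true_eq_false, if_false, if_true, zero_add, Nat.cast_zero, add_zero,
    Nat.cast_add, Nat.cast_one, ← add_assoc, add_comm 1, Nat.add_right_cancel_iff,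
    add_right_comm _ _ (1 : ℤ)]
  tauto

theorem not_isValidPath_cons_true_zero {L : ℕ} (ok : ℤ → ℤ → Prop) (a b : ℤ)
    (s : Fin L → Bool) :
    ¬ IsValidPath ok a b 0 (Fin.cons true s : Fin (L + 1) → Bool) := by
  simp [IsValidPath, countUpto_cons_succ]

open Classical in
theorem validPathCount_succ (ok : ℤ → ℤ → Prop) (L : ℕ) (a b : ℤ) (r : ℕ) :
    validPathCount ok (L + 1) a b r =
      (Finset.univ.filter fun s : Fin L → Bool =>
        IsValidPath ok a b r (Fin.cons true s : Fin (L + 1) → Bool)).card +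
      (Finset.univ.filter fun s : Fin L → Bool =>
        IsValidPath ok a b r (Fin.cons false s : Fin (L + 1) → Bool)).card := by
  simp only [validPathCount, Finset.card_filter]
  rw [← Equiv.sum_comp (Fin.consEquiv fun _ : Fin (L + 1) => Bool), Fintype.sum_prod_type,
    Fintype.sum_bool]
  rfl

open Classical in
theorem validPathCount_succ_succ {ok : ℤ → ℤ → Prop} (L : ℕ) {a b : ℤ} (r : ℕ) (h : ok a b) :
    validPathCount ok (L + 1) a b (r + 1) =
      validPathCount ok L (a + 1) b r + validPathCount ok L a (b + 1) (r + 1) := by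
  rw [validPathCount_succ]
  refine congrArg₂ (· + ·) (congrArg Finset.card (Finset.filter_congr fun s _ => ?_))
    (congrArg Finset.card (Finset.filter_congr fun s _ => ?_))
  · rw [isValidPath_cons_true_succ, and_iff_right h]
  · rw [isValidPath_cons_false, and_iff_right h]

open Classical in
theorem validPathCount_succ_zero {ok : ℤ → ℤ → Prop} (L : ℕ) {a b : ℤ} (h : ok a b) :
    validPathCount ok (L + 1) a b 0 = validPathCount ok L a (b + 1) 0 := by
  rw [validPathCount_succ, Finset.filter_false_of_mem
    fun s _ => not_isValidPath_cons_true_zero ok a b s, Finset.card_empty, zero_add]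
  refine congrArg Finset.card (Finset.filter_congr fun s _ => ?_)
  rw [isValidPath_cons_false, and_iff_right h]

theorem validPathCount_zero_zero {ok : ℤ → ℤ → Prop} {a b : ℤ} (h : ok a b) :
    validPathCount ok 0 a b 0 = 1 := by
  simp [validPathCount, IsValidPath, countUpto_zero, h]

theorem validPathCount_of_not {ok : ℤ → ℤ → Prop} (L : ℕ) {a b : ℤ} (r : ℕ) (h : ¬ ok a b) :
    validPathCount ok L a b r = 0 := by
  simp only [validPathCount, Finset.card_eq_zero, Finset.filter_eq_empty_iff]
  intro s _ hs
  exact h (by simpa [countUpto_zero] using hs.2 0 (Nat.zero_le _))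

/-- The generalized ballot theorem, for paths read from their endpoint on the line `y = p x`. -/
theorem mul_validPathCount (p : ℕ) (hp : 1 ≤ p) (L r u : ℕ) (a b : ℤ) (hL : r + u = L)
    (hb : b + u = p * (a + r)) (hr : p * r ≤ u + 1) :
    ((u : ℤ) + 1) * validPathCount (fun x y => y ≤ (p : ℤ) * x) L a b r =
      ((u : ℤ) + 1 - p * r) * L.choose r := by
  induction L generalizing r u a b with
  | zero =>
    obtain ⟨rfl, rfl⟩ : r = 0 ∧ u = 0 := by omega
    rw [validPathCount_zero_zero (by push_cast at hb; linarith)]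
    simp
  | succ L ih =>
    rcases hr.eq_or_lt with h | h
    · have h' : (p : ℤ) * r = u + 1 := by exact_mod_cast h
      rw [validPathCount_of_not _ _ (by rw [not_le]; linarith), h']
      simp
    have h' : (p : ℤ) * r ≤ u := by exact_mod_cast Nat.lt_succ_iff.mp h
    have hok : b ≤ (p : ℤ) * a := by linarith
    cases r with
    | zero =>
      obtain rfl : u = L + 1 := by omega
      have key := ih 0 L a (b + 1) (by omega) (by push_cast at hb ⊢; linarith) (by omega)
      rw [validPathCount_succ_zero (ok := fun x y => y ≤ (p : ℤ) * x) _ hok]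
      have : ((L : ℤ) + 1) ≠ 0 := by positivity
      simp only [Nat.cast_zero, mul_zero, sub_zero, Nat.choose_zero_right] at key ⊢
      rw [mul_left_cancel₀ this key]
    | succ r =>
      obtain ⟨u, rfl⟩ : ∃ v, u = v + 1 :=
        Nat.exists_eq_succ_of_ne_zero (by rintro rfl; push_cast at h'; nlinarith)
      have hX := ih r (u + 1) (a + 1) b (by omega) (by push_cast at hb ⊢; linarith)
        (by zify; push_cast at h' ⊢; nlinarith)
      have hY := ih (r + 1) u a (b + 1) (by omega) (by push_cast at hb ⊢; linarith)
        (by zify; push_cast at h' ⊢; linarith)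
      have hC : (L.choose (r + 1) : ℤ) * (r + 1) = L.choose r * (u + 1) := by
        have := Nat.choose_succ_right_eq L r
        rw [show L - r = u + 1 by omega] at this
        exact_mod_cast this
      rw [validPathCount_succ_succ (ok := fun x y => y ≤ (p : ℤ) * x) _ _ hok,
        Nat.choose_succ_succ]
      have hu : ((u : ℤ) + 1) ≠ 0 := by positivity
      apply mul_left_cancel₀ hu
      push_cast at hX hY ⊢
      linear_combination ((u : ℤ) + 1) * hX + ((u : ℤ) + 2) * hY - (p : ℤ) * hC

theorem monoPathCount_eq_validPathCount (a b : ℤ) (r u : ℕ) (ok : ℤ → ℤ → Prop)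
    [∀ x y, Decidable (ok x y)] :
    monoPathCount a b r u ok = validPathCount ok (r + u) a b r := by
  unfold monoPathCount validPathCount IsValidPath
  congr

/-- For `p ≥ 1`, `(pn+1)` times the number of lattice paths from `(0,0)` to `(n, pn)` all
of whose points `(a,b)` satisfy `b ≤ pa` equals `C((p+1)n, n)`. -/
theorem stmt_13 (p : ℕ) (hp : 1 ≤ p) (n : ℕ) :
    (p * n + 1) * monoPathCount 0 0 n (p * n) (fun x y => y ≤ (p : ℤ) * x) =
      ((p + 1) * n).choose n := by
  have key := mul_validPathCount p hp (n + p * n) n (p * n) 0 0 rfl (by push_cast; ring)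
    (by omega)
  rw [monoPathCount_eq_validPathCount, show (p + 1) * n = n + p * n by ring]
  zify
  push_cast at key
  linear_combination key
end
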